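/- Fix n ≥ 2 and nonzero complex numbers A_i, B_i, C_i, D_i and Ā_i, B̄_i, C̄_i, D̄_i for i = 1,…,n−1. Define χ⁺_i = B_i·C_i·A_i·D_{i+1}/(A_{i−1}·D_i) and χ⁻_i = B_i·C_i·D_i·A_{i+1}/(D_{i−1}·A_i) (conventions A₀ = D₀ = A_n = D_n = 1), and χ̄⁺_i, χ̄⁻_i by the same formulas in the barred variables. Assume: (1) U_1(A_1,B_1)⋯U_{n−1}(A_{n−1},B_{n−1})·L_1(D_1,C_1)⁻¹⋯L_{n−1}(D_{n−1},C_{n−1})⁻¹ = L_1(D̄_1,C̄_1)⁻¹⋯L_{n−1}(D̄_{n−1},C̄_{n−1})⁻¹·U_1(Ā_1,B̄_1)⋯U_{n−1}(Ā_{n−1},B̄_{n−1}); (2) A_i·D_i = Ā_i·D̄_i for all i; (3) χ⁻_i ≠ 1 for all i. Then χ̄⁺_i = χ⁻_i and χ̄⁻_i = (χ⁻_i)²·(χ⁺_i)⁻¹·(1−χ⁻_i)⁻²·(1−χ⁻_{i−1})·(1−χ⁻_{i+1}) for all i, with the conventions χ⁻_0 = χ⁻_n = 0. (The factorization relation on the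 Coxeter symplectic leaf of SL_n acts in the coordinates χ± by the explicit map α.) -/

import Mathlib

open scoped Matrix

/-- `Umat n i A B` is the `n×n` identity matrix except that its `2×2` submatrix in
rows and columns `i, i+1` (1-based indexing, `1 ≤ i ≤ n-1`) is `[[A, B], [0, A⁻¹]]`. -/
noncomputable def Umat (n : ℕ) (i : ℕ) (A B : ℂ) : Matrix (Fin n) (Fin n) ℂ := fun j k =>
  if (j : ℕ) + 1 = i ∧ (k : ℕ) + 1 = i then A
  else if (j : ℕ) + 1 = i ∧ (k : ℕ) = i then B
  else if (j : ℕ) = i ∧ (k : ℕ) = i then A⁻¹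
  else if j = k then 1 else 0

/-- `Lmat n i D C` is the `n×n` identity matrix except that its `2×2` submatrix in
rows and columns `i, i+1` (1-based indexing, `1 ≤ i ≤ n-1`) is `[[D, 0], [C, D⁻¹]]`. -/
noncomputable def Lmat (n : ℕ) (i : ℕ) (D C : ℂ) : Matrix (Fin n) (Fin n) ℂ := fun j k =>
  if (j : ℕ) + 1 = i ∧ (k : ℕ) + 1 = i then D
  else if (j : ℕ) = i ∧ (k : ℕ) + 1 = i then C
  else if (j : ℕ) = i ∧ (k : ℕ) = i then D⁻¹
  else if j = k then 1 else 0

/-- The coordinate `χ⁺_i = B_i·C_i·A_i·D_{i+1}/(A_{i-1}·D_i)` for `1 ≤ i ≤ n-1`,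
extended by `0` outside this range (conventions `χ⁺_0 = χ⁺_n = 0`). -/
noncomputable def chiP (n : ℕ) (A B C D : ℕ → ℂ) (i : ℕ) : ℂ :=
  if 1 ≤ i ∧ i ≤ n - 1 then B i * C i * A i * D (i + 1) / (A (i - 1) * D i) else 0

/-- The coordinate `χ⁻_i = B_i·C_i·D_i·A_{i+1}/(D_{i-1}·A_i)` for `1 ≤ i ≤ n-1`,
extended by `0` outside this range (conventions `χ⁻_0 = χ⁻_n = 0`). -/
noncomputable def chiM (n : ℕ) (A B C D : ℕ → ℂ) (i : ℕ) : ℂ :=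
  if 1 ≤ i ∧ i ≤ n - 1 then B i * C i * D i * A (i + 1) / (D (i - 1) * A i) else 0

/-- lower bidiagonal matrix -/
noncomputable def Bd (n : ℕ) (d e : ℕ → ℂ) : Matrix (Fin n) (Fin n) ℂ := fun j k =>
  if (j : ℕ) = k then d j else if (j : ℕ) = k + 1 then e k else 0

lemma Bd_mul (n : ℕ) (d e : ℕ → ℂ) (Y : Matrix (Fin n) (Fin n) ℂ) (j k : Fin n) :
    (Bd n d e * Y) j k = d j * Y j k +
      if h : 0 < (j : ℕ) then e (j - 1) * Y ⟨j - 1, by omega⟩ k else 0 := by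
  rw [Matrix.mul_apply]
  split_ifs with h
  · have hs : ∀ l : Fin n, Bd n d e j l * Y l k = (if l = j then d j * Y j k else 0) +
        (if l = ⟨j - 1, by omega⟩ then e (j - 1) * Y ⟨j - 1, by omega⟩ k else 0) := by
      intro l
      by_cases h1 : l = j
      · subst h1
        have : ¬ l = ⟨l - 1, by omega⟩ := by rw [Fin.ext_iff]; simp; omega
        simp [Bd, this]
      · by_cases h2 : l = ⟨j - 1, by omega⟩
        · have h3 : (l : ℕ) = j - 1 := by rw [h2]
          have h4 : ¬ (j : ℕ) = l := by omega
          have h5 : (j : ℕ) = l + 1 := by omega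
          rw [if_neg h1, if_pos h2, ← h2, ← h3, zero_add]
          unfold Bd
          rw [if_neg h4, if_pos h5]
        · rw [if_neg h1, if_neg h2]
          rw [Fin.ext_iff] at h1 h2
          simp only at h2
          unfold Bd
          rw [if_neg (by omega), if_neg (by omega)]
          simp
    simp only [hs, Finset.sum_add_distrib, Finset.sum_ite_eq', Finset.mem_univ, if_true]
  · have hs : ∀ l : Fin n, Bd n d e j l * Y l k = (if l = j then d j * Y j k else 0) := by
      intro l
      by_cases h1 : l = j
      · subst h1
        simp [Bd]
      · rw [if_neg h1]
        rw [Fin.ext_iff] at h1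
        unfold Bd
        rw [if_neg (by omega), if_neg (by omega)]
        simp
    simp only [hs, Finset.sum_ite_eq', Finset.mem_univ, if_true, add_zero]

lemma BdT_mul (n : ℕ) (d e : ℕ → ℂ) (Y : Matrix (Fin n) (Fin n) ℂ) (j k : Fin n) :
    ((Bd n d e)ᵀ * Y) j k = d j * Y j k +
      if h : (j : ℕ) + 1 < n then e j * Y ⟨j + 1, h⟩ k else 0 := by
  rw [Matrix.mul_apply]
  simp only [Matrix.transpose_apply]
  split_ifs with h
  · have hs : ∀ l : Fin n, Bd n d e l j * Y l k = (if l = j then d j * Y j k else 0) +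
        (if l = ⟨j + 1, h⟩ then e j * Y ⟨j + 1, h⟩ k else 0) := by
      intro l
      by_cases h1 : l = j
      · subst h1
        have : ¬ l = ⟨l + 1, by omega⟩ := by rw [Fin.ext_iff]; simp
        simp [Bd, this]
      · by_cases h2 : l = ⟨j + 1, h⟩
        · have h3 : (l : ℕ) = j + 1 := by rw [h2]
          rw [if_neg h1, if_pos h2, ← h2, zero_add]
          unfold Bd
          rw [if_neg (by omega), if_pos h3]
        · rw [if_neg h1, if_neg h2]
          rw [Fin.ext_iff] at h1 h2
          simp only at h2
          unfold Bd
          rw [if_neg (by omega), if_neg (by omega)]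
          simp
    simp only [hs, Finset.sum_add_distrib, Finset.sum_ite_eq', Finset.mem_univ, if_true]
  · have hs : ∀ l : Fin n, Bd n d e l j * Y l k = (if l = j then d j * Y j k else 0) := by
      intro l
      by_cases h1 : l = j
      · subst h1
        simp [Bd]
      · rw [if_neg h1]
        rw [Fin.ext_iff] at h1
        unfold Bd
        rw [if_neg (by omega), if_neg (by omega)]
        simp
    simp only [hs, Finset.sum_ite_eq', Finset.mem_univ, if_true, add_zero]

lemma Bd_mul_Bd (n : ℕ) (d e d' e' : ℕ → ℂ) (h : ∀ k, e (k + 1) * e' k = 0) :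
    Bd n d e * Bd n d' e' =
      Bd n (fun j => d j * d' j) (fun k => d (k + 1) * e' k + e k * d' k) := by
  ext ⟨j, hj⟩ ⟨k, hk⟩
  rw [Bd_mul]
  simp only [Bd]
  rcases Nat.eq_zero_or_pos j with rfl | h0
  · by_cases h1 : 0 = k
    · simp [h1]
    · simp [h1]
  · obtain ⟨p, rfl⟩ : ∃ p, j = p + 1 := ⟨j - 1, by omega⟩
    simp only [Nat.add_sub_cancel, Nat.succ_pos, dif_pos]
    by_cases h1 : p + 1 = k
    · subst h1; simp [show p ≠ p + 1 + 1 by omega]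
    · by_cases h2 : p = k
      · subst h2; simp
      · by_cases h3 : p = k + 1
        · subst h3; simp [h]
        · simp [h1, h2, h3]

lemma Bd_congr (n : ℕ) (d e d' e' : ℕ → ℂ) (h1 : ∀ j, j < n → d j = d' j)
    (h2 : ∀ j, j + 1 < n → e j = e' j) : Bd n d e = Bd n d' e' := by
  ext ⟨j, hj⟩ ⟨k, hk⟩
  simp only [Bd]
  split_ifs with h3 h4
  · exact h1 _ hj
  · exact h2 _ (by omega)
  · rfl

lemma Lmat_eq (n r : ℕ) (D C : ℂ) : Lmat n (r + 1) D C =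
    Bd n (fun j => if j = r then D else if j = r + 1 then D⁻¹ else 1)
      (fun k => if k = r then C else 0) := by
  ext ⟨j, hj⟩ ⟨k, hk⟩
  simp only [Bd, Lmat, Fin.mk.injEq]
  split_ifs <;> first | rfl | omega

lemma Bd_one (n : ℕ) : Bd n (fun _ => 1) (fun _ => 0) = 1 := by
  ext ⟨j, hj⟩ ⟨k, hk⟩
  simp only [Bd, Matrix.one_apply, Fin.mk.injEq]
  split_ifs <;> rfl

/-- explicit inverse of `Lmat` -/
noncomputable def Linv (n r : ℕ) (D C : ℂ) : Matrix (Fin n) (Fin n) ℂ :=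
    Bd n (fun j => if j = r then D⁻¹ else if j = r + 1 then D else 1)
      (fun k => if k = r then -C else 0)

lemma Linv_mul (n r : ℕ) (D C : ℂ) (hD : D ≠ 0) : Linv n r D C * Lmat n (r + 1) D C = 1 := by
  rw [Lmat_eq, Linv, Bd_mul_Bd, ← Bd_one]
  · apply Bd_congr
    · intro j _
      split_ifs <;> simp [hD]
    · intro j _
      by_cases h : j = r
      · subst h; simp; ring
      · simp [h]
  · intro k
    by_cases h : k = r
    · subst h; simp
    · simp [h]

lemma Lmat_inv (n r : ℕ) (D C : ℂ) (hD : D ≠ 0) : (Lmat n (r + 1) D C)⁻¹ = Linv n r D C :=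
  Matrix.inv_eq_left_inv (Linv_mul n r D C hD)

lemma Umat_T (n i : ℕ) (A B : ℂ) : (Umat n i A B)ᵀ = Lmat n i A B := by
  ext j k
  simp only [Matrix.transpose_apply, Umat, Lmat, Fin.ext_iff]
  split_ifs <;> first | rfl | omega

lemma partialL (n : ℕ) (D C : ℕ → ℂ) (hD0 : D 0 = 1) (r : ℕ)
    (hD : ∀ i, 1 ≤ i → i ≤ r → D i ≠ 0) :
    ((List.range' 1 r).map (fun i => (Lmat n i (D i) (C i))⁻¹)).prod =
      Bd n (fun j => if j < r then D j / D (j + 1) else if j = r then D r else 1)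
        (fun k => if k < r then -C (k + 1) else 0) := by
  induction r with
  | zero =>
    rw [List.range'_zero, List.map_nil, List.prod_nil, ← Bd_one]
    apply Bd_congr
    · intro j _
      by_cases h : j = 0 <;> simp [h, hD0]
    · simp
  | succ r ih =>
    rw [List.range'_concat, List.map_append, List.prod_append,
      ih (fun i h1 h2 => hD i h1 (by omega))]
    simp only [List.map_cons, List.map_nil, List.prod_cons, List.prod_nil, mul_one, one_mul]
    rw [Nat.add_comm 1 r, Lmat_inv _ _ _ _ (hD _ (by omega) le_rfl), Linv, Bd_mul_Bd]
    · apply Bd_congr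
      · intro j _
        rcases lt_trichotomy j r with h | rfl | h
        · simp [h, h.ne, show j ≠ r + 1 by omega, show j < r + 1 by omega]
        · simp [div_eq_mul_inv]
        · by_cases h' : j = r + 1
          · subst h'; simp
          · simp [h', h.ne', show ¬ j < r by omega, show ¬ j < r + 1 by omega]
      · intro j _
        rcases lt_trichotomy j r with h | rfl | h
        · simp [h, h.ne, show j ≠ r + 1 by omega, show j < r + 1 by omega]
        · simp
        · simp [h.ne', show ¬ j < r by omega, show ¬ j < r + 1 by omega]
    · intro k
      by_cases h : k = r
      · subst h; simp
      · simp [h]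

lemma partialU (n : ℕ) (A B : ℕ → ℂ) (r : ℕ) (hA : ∀ i, 1 ≤ i → i ≤ r → A i ≠ 0) :
    ((List.range' 1 r).map (fun i => (Lmat n i (A i) (B i))⁻¹)).prod *
      (((List.range' 1 r).map (fun i => Umat n i (A i) (B i))).prod)ᵀ = 1 := by
  induction r with
  | zero => simp
  | succ r ih =>
    have ih' := ih (fun i h1 h2 => hA i h1 (by omega))
    rw [List.range'_concat, List.map_append, List.prod_append, List.map_append, List.prod_append]
    simp only [List.map_cons, List.map_nil, List.prod_cons, List.prod_nil, mul_one, one_mul]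
    rw [Matrix.transpose_mul, Umat_T, Nat.add_comm 1 r,
      Lmat_inv _ _ _ _ (hA _ (by omega) le_rfl), Matrix.mul_assoc,
      ← Matrix.mul_assoc (Linv _ _ _ _), Linv_mul _ _ _ _ (hA _ (by omega) le_rfl),
      Matrix.one_mul, ih']

lemma fullL (n : ℕ) (hn : 2 ≤ n) (D C : ℕ → ℂ) (hD0 : D 0 = 1) (hDn : D n = 1)
    (hD : ∀ i, 1 ≤ i → i ≤ n - 1 → D i ≠ 0) :
    ((List.range' 1 (n - 1)).map (fun i => (Lmat n i (D i) (C i))⁻¹)).prod =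
      Bd n (fun j => D j / D (j + 1)) (fun k => -C (k + 1)) := by
  rw [partialL n D C hD0 _ hD]
  apply Bd_congr
  · intro j hj
    by_cases h : j < n - 1
    · simp [h]
    · have : j = n - 1 := by omega
      subst this
      simp [show n - 1 + 1 = n by omega, hDn]
  · intro j hj
    simp [show j < n - 1 by omega]

/-- The factorization relation on the Coxeter symplectic leaf of `SL_n` acts in the
coordinates `χ^±` by the explicit map `α`: if
`U₁(A₁,B₁)⋯U_{n−1}·L₁(D₁,C₁)⁻¹⋯L_{n−1}⁻¹ = L̄₁⁻¹⋯L̄_{n−1}⁻¹·Ū₁⋯Ū_{n−1}` with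
`A_i·D_i = Ā_i·D̄_i` and `χ⁻_i ≠ 1`, then `χ̄⁺_i = χ⁻_i` and
`χ̄⁻_i = (χ⁻_i)²·(χ⁺_i)⁻¹·(1−χ⁻_i)⁻²·(1−χ⁻_{i−1})·(1−χ⁻_{i+1})`
(conventions `A₀ = D₀ = A_n = D_n = 1` and `χ⁻_0 = χ⁻_n = 0`). -/
theorem factorization_relation_explicit_map
    (n : ℕ) (hn : 2 ≤ n) (A B C D Ab Bb Cb Db : ℕ → ℂ)
    (hA : ∀ i, 1 ≤ i → i ≤ n - 1 → A i ≠ 0) (hB : ∀ i, 1 ≤ i → i ≤ n - 1 → B i ≠ 0)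
    (hC : ∀ i, 1 ≤ i → i ≤ n - 1 → C i ≠ 0) (hD : ∀ i, 1 ≤ i → i ≤ n - 1 → D i ≠ 0)
    (hAb : ∀ i, 1 ≤ i → i ≤ n - 1 → Ab i ≠ 0) (hBb : ∀ i, 1 ≤ i → i ≤ n - 1 → Bb i ≠ 0)
    (hCb : ∀ i, 1 ≤ i → i ≤ n - 1 → Cb i ≠ 0) (hDb : ∀ i, 1 ≤ i → i ≤ n - 1 → Db i ≠ 0)
    (hA0 : A 0 = 1) (hAn : A n = 1) (hD0 : D 0 = 1) (hDn : D n = 1)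
    (hAb0 : Ab 0 = 1) (hAbn : Ab n = 1) (hDb0 : Db 0 = 1) (hDbn : Db n = 1)
    (hfac : ((List.range' 1 (n - 1)).map (fun i => Umat n i (A i) (B i))).prod *
        ((List.range' 1 (n - 1)).map (fun i => (Lmat n i (D i) (C i))⁻¹)).prod =
      ((List.range' 1 (n - 1)).map (fun i => (Lmat n i (Db i) (Cb i))⁻¹)).prod *
        ((List.range' 1 (n - 1)).map (fun i => Umat n i (Ab i) (Bb i))).prod)
    (hdiag : ∀ i, 1 ≤ i → i ≤ n - 1 → A i * D i = Ab i * Db i)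
    (hne1 : ∀ i, 1 ≤ i → i ≤ n - 1 → chiM n A B C D i ≠ 1) :
    ∀ i, 1 ≤ i → i ≤ n - 1 →
      chiP n Ab Bb Cb Db i = chiM n A B C D i ∧
      chiM n Ab Bb Cb Db i =
        (chiM n A B C D i) ^ 2 * (chiP n A B C D i)⁻¹ * ((1 - chiM n A B C D i) ^ 2)⁻¹ *
          (1 - chiM n A B C D (i - 1)) * (1 - chiM n A B C D (i + 1)) := by
  have key : Bd n (fun j => D j / D (j + 1)) (fun k => -C (k + 1)) *
      (Bd n (fun j => Ab j / Ab (j + 1)) (fun k => -Bb (k + 1)))ᵀ =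
      (Bd n (fun j => A j / A (j + 1)) (fun k => -B (k + 1)))ᵀ *
      Bd n (fun j => Db j / Db (j + 1)) (fun k => -Cb (k + 1)) := by
    have h1 := partialU n A B (n - 1) hA
    have h2 := partialU n Ab Bb (n - 1) hAb
    rw [fullL n hn _ _ hA0 hAn hA] at h1
    rw [fullL n hn _ _ hAb0 hAbn hAb] at h2
    rw [fullL n hn _ _ hD0 hDn hD, fullL n hn _ _ hDb0 hDbn hDb] at hfac
    have h1' := congrArg Matrix.transpose (mul_eq_one_comm.mp h1)
    have h2' := congrArg Matrix.transpose h2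
    rw [Matrix.transpose_mul, Matrix.transpose_transpose, Matrix.transpose_one] at h1' h2'
    rw [← Matrix.one_mul (Bd n (fun j => D j / D (j + 1)) _), ← h1', Matrix.mul_assoc,
      Matrix.mul_assoc, ← Matrix.mul_assoc _ _ (Bd n (fun j => Ab j / Ab (j + 1)) _)ᵀ, hfac,
      Matrix.mul_assoc, h2', Matrix.mul_one]
  have nz : ∀ (X : ℕ → ℂ), X 0 = 1 → X n = 1 → (∀ i, 1 ≤ i → i ≤ n - 1 → X i ≠ 0) →
      ∀ i, i ≤ n → X i ≠ 0 := by
    intro X h0 h1 h i hi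
    rcases Nat.eq_zero_or_pos i with rfl | hp
    · rw [h0]; exact one_ne_zero
    · rcases Nat.eq_or_lt_of_le hi with rfl | hl
      · rw [h1]; exact one_ne_zero
      · exact h i hp (by omega)
  have nA := nz A hA0 hAn hA
  have nD := nz D hD0 hDn hD
  have nAb := nz Ab hAb0 hAbn hAb
  have nDb := nz Db hDb0 hDbn hDb
  have hdg : ∀ i, i ≤ n → A i * D i = Ab i * Db i := by
    intro i hi
    rcases Nat.eq_zero_or_pos i with rfl | hp
    · simp [*]
    · rcases Nat.eq_or_lt_of_le hi with rfl | hl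
      · simp [*]
      · exact hdiag i hp (by omega)
  have eB : ∀ k, k + 1 < n → D k / D (k + 1) * Bb (k + 1) =
      B (k + 1) * (Db (k + 1) / Db (k + 2)) := by
    intro k hk
    have := congrFun (congrFun key ⟨k, by omega⟩) ⟨k + 1, hk⟩
    rw [Bd_mul, BdT_mul] at this
    simp only [Matrix.transpose_apply, Bd] at this
    rw [dif_pos hk] at this
    rcases Nat.eq_zero_or_pos k with rfl | hp
    · simpa using this
    · simpa [hp, show k + 1 ≠ k - 1 by omega, show k ≠ k - 1 by omega,
        show k ≠ k + 1 + 1 by omega] using this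
  have eC : ∀ k, k + 1 < n → C (k + 1) * (Ab k / Ab (k + 1)) =
      A (k + 1) / A (k + 2) * Cb (k + 1) := by
    intro k hk
    have := congrFun (congrFun key ⟨k + 1, hk⟩) ⟨k, by omega⟩
    rw [Bd_mul, BdT_mul] at this
    simp only [Matrix.transpose_apply, Bd] at this
    simpa [show k ≠ k + 1 + 1 by omega, show k + 1 + 1 ≠ k by omega] using this
  have e0 : D 0 / D 1 * (Ab 0 / Ab 1) = A 0 / A 1 * (Db 0 / Db 1) + B 1 * Cb 1 := by
    have := congrFun (congrFun key ⟨0, by omega⟩) ⟨0, by omega⟩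
    rw [Bd_mul, BdT_mul] at this
    simp only [Matrix.transpose_apply, Bd] at this
    simpa [show 1 < n by omega] using this
  have eD : ∀ k, k + 1 < n → D (k + 1) / D (k + 2) * (Ab (k + 1) / Ab (k + 2)) +
      C (k + 1) * Bb (k + 1) = A (k + 1) / A (k + 2) * (Db (k + 1) / Db (k + 2)) +
      if k + 2 < n then B (k + 2) * Cb (k + 2) else 0 := by
    intro k hk
    have := congrFun (congrFun key ⟨k + 1, hk⟩) ⟨k + 1, hk⟩
    rw [Bd_mul, BdT_mul] at this
    simp only [Matrix.transpose_apply, Bd] at this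
    simpa [add_assoc] using this
  -- value of chiM
  have cM : ∀ k, k + 1 < n → chiM n A B C D (k + 1) =
      B (k + 1) * C (k + 1) * D (k + 1) * A (k + 2) / (D k * A (k + 1)) := by
    intro k hk
    rw [chiM, if_pos ⟨by omega, by omega⟩, Nat.add_sub_cancel]
  have c0 : chiM n A B C D 0 = 0 := by rw [chiM, if_neg (by omega)]
  have cn : ∀ k, n ≤ k → chiM n A B C D k = 0 := by
    intro k hk
    rw [chiM, if_neg (by omega)]
  have bC : ∀ k, k + 1 < n → B (k + 1) * Cb (k + 1) =
      chiM n A B C D (k + 1) * (D k / D (k + 1) * (Ab k / Ab (k + 1))) := by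
    intro k hk
    have h := eC k hk
    have := nA (k + 1) (by omega)
    have := nA (k + 2) (by omega)
    have := nAb (k + 1) (by omega)
    have := nD k (by omega)
    have := nD (k + 1) (by omega)
    have h' : Cb (k + 1) = C (k + 1) * (Ab k / Ab (k + 1)) * (A (k + 2) / A (k + 1)) := by
      rw [h]; field_simp
    rw [cM k hk, h']
    field_simp
  have cB : ∀ k, k + 1 < n → C (k + 1) * Bb (k + 1) =
      chiM n A B C D (k + 1) * (A (k + 1) / A (k + 2) * (Db (k + 1) / Db (k + 2))) := by
    intro k hk
    have h := eB k hk
    have := nA (k + 1) (by omega)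
    have := nA (k + 2) (by omega)
    have := nDb (k + 2) (by omega)
    have := nD k (by omega)
    have := nD (k + 1) (by omega)
    have h' : Bb (k + 1) = B (k + 1) * (Db (k + 1) / Db (k + 2)) * (D (k + 1) / D k) := by
      rw [← h]; field_simp
    rw [cM k hk, h']
    field_simp
  have rel : ∀ k, k < n → D k / D (k + 1) * (Ab k / Ab (k + 1)) * (1 - chiM n A B C D (k + 1)) =
      A k / A (k + 1) * (Db k / Db (k + 1)) * (1 - chiM n A B C D k) := by
    intro k hk
    rcases Nat.eq_zero_or_pos k with rfl | hp
    · have h := bC 0 (by omega)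
      simp only [zero_add] at h ⊢
      rw [c0]
      linear_combination e0 + h
    · obtain ⟨p, rfl⟩ : ∃ p, k = p + 1 := ⟨k - 1, by omega⟩
      have h1 := eD p hk
      rw [cB p hk] at h1
      split_ifs at h1 with h2
      · have h := bC (p + 1) h2
        simp only [add_assoc, Nat.reduceAdd] at h h1 ⊢
        linear_combination h1 + h
      · rw [cn (p + 1 + 1) (by omega)]
        simp only [add_assoc, Nat.reduceAdd] at h1 ⊢
        linear_combination h1
  intro i hi1 hi2
  obtain ⟨k, rfl⟩ : ∃ k, i = k + 1 := ⟨i - 1, by omega⟩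
  have hk : k + 1 < n := by omega
  have r1 := rel k (by omega)
  have r2 := rel (k + 1) hk
  have x1 := hne1 (k + 1) hi1 hi2
  have g0 := hdg k (by omega)
  have g1 := hdg (k + 1) (by omega)
  have g2 := hdg (k + 2) (by omega)
  have hb := eB k hk
  have hc := eC k hk
  have hcm := cM k hk
  have a0 := nA k (by omega)
  have a1 := nA (k + 1) (by omega)
  have a2 := nA (k + 2) (by omega)
  have d0 := nD k (by omega)
  have d1 := nD (k + 1) (by omega)
  have d2 := nD (k + 2) (by omega)
  have a0' := nAb k (by omega)
  have a1' := nAb (k + 1) (by omega)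
  have a2' := nAb (k + 2) (by omega)
  have d0' := nDb k (by omega)
  have d1' := nDb (k + 1) (by omega)
  have d2' := nDb (k + 2) (by omega)
  have b1 := hB (k + 1) hi1 hi2
  have c1 := hC (k + 1) hi1 hi2
  have hb' : Bb (k + 1) = B (k + 1) * (Db (k + 1) / Db (k + 2)) * (D (k + 1) / D k) := by
    rw [← hb]; field_simp
  have hc' : Cb (k + 1) = C (k + 1) * (Ab k / Ab (k + 1)) * (A (k + 2) / A (k + 1)) := by
    rw [hc]; field_simp
  have hP : ∀ A B C D : ℕ → ℂ, chiP n A B C D (k + 1) =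
      B (k + 1) * C (k + 1) * A (k + 1) * D (k + 2) / (A k * D (k + 1)) := by
    intro A B C D
    rw [chiP, if_pos ⟨by omega, by omega⟩, Nat.add_sub_cancel]
  have hM : chiM n Ab Bb Cb Db (k + 1) =
      Bb (k + 1) * Cb (k + 1) * Db (k + 1) * Ab (k + 2) / (Db k * Ab (k + 1)) := by
    rw [chiM, if_pos ⟨by omega, by omega⟩, Nat.add_sub_cancel]
  refine ⟨?_, ?_⟩
  · rw [hP, hcm, hb', hc']
    field_simp
  · rw [hM, hP, hb', hc', Nat.add_sub_cancel]
    simp only [add_assoc, Nat.reduceAdd] at r1 r2 ⊢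
    set x0 := chiM n A B C D k
    set x := chiM n A B C D (k + 1)
    set x2 := chiM n A B C D (k + 2)
    have hx : 1 - x ≠ 0 := sub_ne_zero.mpr (Ne.symm x1)
    have s0 : 1 - x0 = D k / D (k + 1) * (Ab k / Ab (k + 1)) * (1 - x) /
        (A k / A (k + 1) * (Db k / Db (k + 1))) := by
      rw [r1]; field_simp
    have s2 : 1 - x2 = A (k + 1) / A (k + 2) * (Db (k + 1) / Db (k + 2)) * (1 - x) /
        (D (k + 1) / D (k + 2) * (Ab (k + 1) / Ab (k + 2))) := by
      rw [← r2]; field_simp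
    rw [s0, s2]
    generalize 1 - x = y at hx ⊢
    rw [hcm]
    have f0 : Ab k = A k * D k / Db k := by rw [g0]; field_simp
    have f1 : Ab (k + 1) = A (k + 1) * D (k + 1) / Db (k + 1) := by rw [g1]; field_simp
    have f2 : Ab (k + 2) = A (k + 2) * D (k + 2) / Db (k + 2) := by rw [g2]; field_simp
    rw [f0, f1, f2]
    field_simp
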